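/- arXiv:2605.17910 — 4 statements merged into one kernel-verified Lean document; each statement's English description precedes it below -/
import Mathlib

section
/- Let b : ℕ → ℝ be a nonincreasing sequence of nonnegative reals (b_1 ≥ b_2 ≥ … ≥ 0) that is summable, let q ∈ ℝ with 1 < q < ∞, and let s ≥ 1 be a natural number. Then (∑_{j ≥ s+1} b_j^q)^{1/q} ≤ s^{-(q-1)/q} · ∑_{j ≥ 1} b_j. -/
theorem Antitone.natCast_mul_le_tsum {b : ℕ → ℝ} (hb : Antitone b) (hb0 : ∀ j, 0 ≤ b j)
    (hsum : Summable b) (n : ℕ) : n * b n ≤ ∑' j, b j :=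
  calc (n : ℝ) * b n = ∑ _j ∈ Finset.range n, b n := by simp
    _ ≤ ∑ j ∈ Finset.range n, b j :=
      Finset.sum_le_sum fun _ hj => hb (Finset.mem_range.mp hj).le
    _ ≤ ∑' j, b j := hsum.sum_le_tsum _ fun j _ => hb0 j


/-- Lemma S.10 (Lemma 6.9 of Bühlmann–van de Geer): for a nonincreasing, nonnegative,
summable sequence `b₁ ≥ b₂ ≥ … ≥ 0` (here `b 0` plays the role of `b₁`), any real
`q > 1`, and any natural `s ≥ 1`,
`(∑_{j ≥ s+1} b_j^q)^{1/q} ≤ s^{-(q-1)/q} · ∑_{j ≥ 1} b_j`. -/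
theorem tail_rpow_sum_le (b : ℕ → ℝ) (hb0 : ∀ j, 0 ≤ b j) (hmono : Antitone b)
    (hsum : Summable b) (q : ℝ) (hq : 1 < q) (s : ℕ) (hs : 1 ≤ s) :
    (∑' j : ℕ, b (j + s) ^ q) ^ (1 / q) ≤ (s : ℝ) ^ (-(q - 1) / q) * ∑' j : ℕ, b j := by
  set S := ∑' j, b j with hS
  have hS0 : 0 ≤ S := tsum_nonneg hb0
  have hs0 : (0 : ℝ) < s := by exact_mod_cast hs
  have hq0 : 0 < q := by linarith
  have hbound (j : ℕ) : b (j + s) ≤ S / s :=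
    (hmono (Nat.le_add_left s j)).trans <|
      (le_div_iff₀' hs0).mpr (hmono.natCast_mul_le_tsum hb0 hsum s)
  have hterm (j : ℕ) : b (j + s) ^ q ≤ (S / s) ^ (q - 1) * b (j + s) :=
    calc b (j + s) ^ q = b (j + s) ^ (q - 1) * b (j + s) := by
          rw [← Real.rpow_add_one' (hb0 _) (by linarith), sub_add_cancel]
      _ ≤ (S / s) ^ (q - 1) * b (j + s) := by
          gcongr
          exacts [hb0 _, hb0 _, hbound j]
  have htail : Summable fun j => b (j + s) := (summable_nat_add_iff s).mpr hsum
  have htail_le : ∑' j, b (j + s) ≤ S := by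
    rw [hS, ← hsum.sum_add_tsum_nat_add s]
    exact le_add_of_nonneg_left (Finset.sum_nonneg fun j _ => hb0 j)
  have hpow : ∑' j, b (j + s) ^ q ≤ ((s : ℝ) ^ (-(q - 1) / q) * S) ^ q :=
    calc ∑' j, b (j + s) ^ q ≤ ∑' j, (S / s) ^ (q - 1) * b (j + s) :=
          Summable.tsum_le_tsum hterm
            (.of_nonneg_of_le (fun j => Real.rpow_nonneg (hb0 _) q) hterm (htail.mul_left _))
            (htail.mul_left _)
      _ ≤ (S / s) ^ (q - 1) * S := by
          rw [tsum_mul_left]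
          gcongr
      _ = (s : ℝ) ^ (-(q - 1)) * (S ^ (q - 1) * S) := by
          rw [Real.div_rpow hS0 hs0.le, Real.rpow_neg hs0.le]
          ring
      _ = ((s : ℝ) ^ (-(q - 1) / q) * S) ^ q := by
          rw [← Real.rpow_add_one' hS0 (by linarith), sub_add_cancel,
            Real.mul_rpow (by positivity) hS0, ← Real.rpow_mul hs0.le, div_mul_cancel₀ _ hq0.ne']
  rw [one_div]
  exact (Real.rpow_inv_le_iff_of_pos (tsum_nonneg fun j => Real.rpow_nonneg (hb0 _) q)
    (by positivity) hq0).mpr hpow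
end

section
/- Let W be a symmetric positive semidefinite real q×q matrix, G a real q×p matrix, M ∈ ℝ^q, and r > 0. Suppose ρ̂ ∈ ℝ^p minimizes ρ ↦ (M − Gρ)ᵀ W (M − Gρ) + 2r‖ρ‖₁ over ℝ^p, and suppose ρ⋆ ∈ ℝ^p satisfies ‖GᵀWM − GᵀWGρ⋆‖_∞ ≤ r/2. Then: (i) (ρ̂ − ρ⋆)ᵀ GᵀWG (ρ̂ − ρ⋆) ≤ 3r‖ρ̂ − ρ⋆‖₁; and (ii) for every index set J ⊆ {1,…,p} such that ρ⋆ vanishes outside J (i.e. (ρ⋆)_{J^c} = 0), one has the cone condition ‖(ρ̂ − ρ⋆)_{J^c}‖₁ ≤ 3‖(ρ̂ − ρ⋆)_J‖₁. -/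
open Matrix

theorem dotProduct_mulVec_sub_self_of_isSymm {n : Type*} [Fintype n] {W : Matrix n n ℝ}
    (hW : W.IsSymm) (a b : n → ℝ) :
    (a - b) ⬝ᵥ W *ᵥ (a - b) = a ⬝ᵥ W *ᵥ a - 2 * (b ⬝ᵥ W *ᵥ a) + b ⬝ᵥ W *ᵥ b := by
  have hab : a ⬝ᵥ W *ᵥ b = b ⬝ᵥ W *ᵥ a := by
    rw [dotProduct_mulVec, ← mulVec_transpose, hW.eq, dotProduct_comm]
  simp only [mulVec_sub, dotProduct_sub, sub_dotProduct, hab]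
  ring

theorem dotProduct_le_mul_sum_abs {n : Type*} [Fintype n] {c : ℝ} {g : n → ℝ}
    (hg : ∀ j, |g j| ≤ c) (d : n → ℝ) : d ⬝ᵥ g ≤ c * ∑ j, |d j| := by
  rw [dotProduct, Finset.mul_sum]
  refine Finset.sum_le_sum fun j _ => (le_abs_self _).trans ?_
  rw [abs_mul, mul_comm]
  exact mul_le_mul_of_nonneg_right (hg j) (abs_nonneg _)

theorem sum_abs_sub_sum_abs_le {n : Type*} (s : Finset n) (x y : n → ℝ) :
    ∑ j ∈ s, |y j| - ∑ j ∈ s, |x j| ≤ ∑ j ∈ s, |(x - y) j| := by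
  rw [← Finset.sum_sub_distrib]
  refine Finset.sum_le_sum fun j _ => ?_
  rw [Pi.sub_apply, abs_sub_comm]
  exact abs_sub_abs_le_abs_sub _ _

theorem dotProduct_mulVec_gram {m n : Type*} [Fintype m] [Fintype n] (W : Matrix m m ℝ)
    (G : Matrix m n ℝ) (x y : n → ℝ) :
    x ⬝ᵥ (Gᵀ * W * G) *ᵥ y = G *ᵥ x ⬝ᵥ W *ᵥ (G *ᵥ y) := by
  rw [Matrix.mul_assoc, ← mulVec_mulVec, ← mulVec_mulVec, dotProduct_mulVec, vecMul_transpose]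

/-- Deterministic content of Lemma S.8: if `ρ̂` minimizes
`ρ ↦ (M − Gρ)ᵀ W (M − Gρ) + 2r‖ρ‖₁` with `W` symmetric positive semidefinite, `r > 0`,
and `ρ⋆` satisfies `‖GᵀWM − GᵀWGρ⋆‖_∞ ≤ r/2`, then
(i) `(ρ̂ − ρ⋆)ᵀ GᵀWG (ρ̂ − ρ⋆) ≤ 3r‖ρ̂ − ρ⋆‖₁` and
(ii) for every index set `J` with `(ρ⋆)_{Jᶜ} = 0`, the cone condition
`‖(ρ̂ − ρ⋆)_{Jᶜ}‖₁ ≤ 3‖(ρ̂ − ρ⋆)_J‖₁` holds. -/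
theorem pgmm_cone_condition {p q : ℕ}
    (W : Matrix (Fin q) (Fin q) ℝ) (hWsymm : W.IsSymm)
    (hWpsd : ∀ v : Fin q → ℝ, 0 ≤ v ⬝ᵥ W.mulVec v)
    (G : Matrix (Fin q) (Fin p) ℝ) (M : Fin q → ℝ) (r : ℝ) (hr : 0 < r)
    (ρhat : Fin p → ℝ)
    (hmin : ∀ ρ : Fin p → ℝ,
      (M - G.mulVec ρhat) ⬝ᵥ W.mulVec (M - G.mulVec ρhat) + 2 * r * ∑ j, |ρhat j| ≤
        (M - G.mulVec ρ) ⬝ᵥ W.mulVec (M - G.mulVec ρ) + 2 * r * ∑ j, |ρ j|)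
    (ρstar : Fin p → ℝ)
    (hstar : ∀ j, |(Gᵀ.mulVec (W.mulVec M) - (Gᵀ * W * G).mulVec ρstar) j| ≤ r / 2) :
    ((ρhat - ρstar) ⬝ᵥ (Gᵀ * W * G).mulVec (ρhat - ρstar) ≤
        3 * r * ∑ j, |ρhat j - ρstar j|) ∧
      (∀ J : Finset (Fin p), (∀ j ∉ J, ρstar j = 0) →
        ∑ j ∈ Jᶜ, |ρhat j - ρstar j| ≤ 3 * ∑ j ∈ J, |ρhat j - ρstar j|) := by
  set d := ρhat - ρstar with hd
  have quad := dotProduct_mulVec_sub_self_of_isSymm hWsymm (M - G *ᵥ ρstar) (G *ᵥ d)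
  have residual : M - G *ᵥ ρstar - G *ᵥ d = M - G *ᵥ ρhat := by
    rw [hd, mulVec_sub]; abel
  have score : d ⬝ᵥ (Gᵀ *ᵥ (W *ᵥ M) - (Gᵀ * W * G) *ᵥ ρstar)
      = G *ᵥ d ⬝ᵥ W *ᵥ (M - G *ᵥ ρstar) := by
    rw [dotProduct_sub, dotProduct_mulVec_gram, dotProduct_mulVec, vecMul_transpose,
      mulVec_sub W, dotProduct_sub]
  have score_le := dotProduct_le_mul_sum_abs hstar d
  have basic : d ⬝ᵥ (Gᵀ * W * G) *ᵥ d ≤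
      r * ∑ j, |d j| + 2 * r * (∑ j, |ρstar j| - ∑ j, |ρhat j|) := by
    have h := hmin ρstar
    rw [residual] at quad
    rw [dotProduct_mulVec_gram]
    linarith
  refine ⟨?_, fun J hJ => ?_⟩
  · have tri : ∑ j, |ρstar j| - ∑ j, |ρhat j| ≤ ∑ j, |d j| :=
      sum_abs_sub_sum_abs_le Finset.univ ρhat ρstar
    have := mul_le_mul_of_nonneg_left tri hr.le
    change _ ≤ 3 * r * ∑ j, |d j|
    linarith
  · have nonneg : 0 ≤ d ⬝ᵥ (Gᵀ * W * G) *ᵥ d := by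
      rw [dotProduct_mulVec_gram]
      exact hWpsd _
    have on_J : ∑ j ∈ J, |ρstar j| - ∑ j ∈ J, |ρhat j| ≤ ∑ j ∈ J, |d j| :=
      sum_abs_sub_sum_abs_le J ρhat ρstar
    have star_compl : ∑ j ∈ Jᶜ, |ρstar j| = 0 :=
      Finset.sum_eq_zero fun j hj => by simp [hJ j (Finset.mem_compl.mp hj)]
    have hat_compl : ∑ j ∈ Jᶜ, |ρhat j| = ∑ j ∈ Jᶜ, |d j| :=
      Finset.sum_congr rfl fun j hj => by simp [hd, hJ j (Finset.mem_compl.mp hj)]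
    rw [← Finset.sum_add_sum_compl J fun j => |d j|,
      ← Finset.sum_add_sum_compl J fun j => |ρstar j|,
      ← Finset.sum_add_sum_compl J fun j => |ρhat j|, star_compl, hat_compl] at basic
    change ∑ j ∈ Jᶜ, |d j| ≤ 3 * ∑ j ∈ J, |d j|
    nlinarith
end

section
/- Let A be a symmetric positive semidefinite real p×p matrix, x̄ ∈ ℝ^p, ε > 0, and S ⊆ {1,…,p} an index set. Suppose ρ⋆ ∈ ℝ^p minimizes the function v ↦ (x̄ − v)ᵀ A (x̄ − v) + 2ε ∑_{j∈S} |v_j| over ℝ^p. Then ‖A(x̄ − ρ⋆)‖_∞ ≤ ε, i.e. for every coordinate j ∈ {1,…,p}, |(A(x̄ − ρ⋆))_j| ≤ ε. -/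
open Matrix

/-- Moving one coordinate by `t` raises a partial ℓ¹ norm by at most `|t|`. -/
theorem sum_abs_add_single_le {ι : Type*} [DecidableEq ι] (S : Finset ι) (x : ι → ℝ) (j : ι)
    (t : ℝ) : ∑ i ∈ S, |(x + Pi.single j t : ι → ℝ) i| ≤ ∑ i ∈ S, |x i| + |t| := by
  calc ∑ i ∈ S, |(x + Pi.single j t : ι → ℝ) i|
      ≤ ∑ i ∈ S, (|x i| + |(Pi.single j t : ι → ℝ) i|) :=
        Finset.sum_le_sum fun i _ => abs_add_le _ _
    _ = ∑ i ∈ S, |x i| + ∑ i ∈ S, (Pi.single j |t| : ι → ℝ) i := by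
        rw [Finset.sum_add_distrib]
        congr 1
        refine Finset.sum_congr rfl fun i _ => ?_
        by_cases h : i = j
        · subst h; simp
        · simp [h]
    _ ≤ ∑ i ∈ S, |x i| + |t| := by
        rw [Finset.sum_pi_single']
        split_ifs <;> simp

/-- The quadratic form of a symmetric matrix along a coordinate line. -/
theorem Matrix.IsSymm.dotProduct_mulVec_sub_single {ι R : Type*} [Fintype ι] [DecidableEq ι]
    [CommRing R] {A : Matrix ι ι R} (hA : A.IsSymm) (w : ι → R) (j : ι) (t : R) :
    (w - Pi.single j t) ⬝ᵥ A *ᵥ (w - Pi.single j t) =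
      w ⬝ᵥ A *ᵥ w - 2 * t * (A *ᵥ w) j + t ^ 2 * A j j := by
  have hcross : w ⬝ᵥ A *ᵥ Pi.single j t = t * (A *ᵥ w) j := by
    rw [dotProduct_mulVec, ← mulVec_transpose, hA.eq, dotProduct_single, mul_comm]
  have hdiag : (A *ᵥ Pi.single j t) j = t * A j j := by
    simp [mulVec, dotProduct_single, mul_comm]
  rw [mulVec_sub, sub_dotProduct, dotProduct_sub, dotProduct_sub, hcross, single_dotProduct,
    single_dotProduct, hdiag]
  ring

/-- A first-order condition extracted from `t * g ≤ O(t ^ 2) + ε * |t|` for all `t`. -/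
theorem abs_le_of_forall_two_mul_le {g a ε : ℝ} (ha : 0 ≤ a)
    (h : ∀ t : ℝ, 2 * t * g ≤ t ^ 2 * a + 2 * ε * |t|) : |g| ≤ ε := by
  have key : ∀ g : ℝ, (∀ t : ℝ, 0 < t → 2 * t * g ≤ t ^ 2 * a + 2 * ε * t) → g ≤ ε := by
    intro g hg
    by_contra! hlt
    have ht : 0 < (g - ε) / (a + 1) := div_pos (by linarith) (by linarith)
    have hmul : (g - ε) / (a + 1) * (a + 1) = g - ε := div_mul_cancel₀ _ (by linarith)
    have := hg _ ht
    generalize (g - ε) / (a + 1) = t at *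
    nlinarith
  refine abs_le'.2 ⟨key g fun t ht => ?_, key (-g) fun t ht => ?_⟩
  · simpa [abs_of_pos ht] using h t
  · simpa [abs_of_pos ht] using h (-t)

/-- Deterministic content of Lemma S.2: if `ρ⋆` minimizes the partially ℓ¹-penalized
quadratic program `v ↦ (x̄ − v)ᵀ A (x̄ − v) + 2ε ∑_{j∈S} |v_j|` with `A` symmetric
positive semidefinite and `ε > 0`, then `‖A(x̄ − ρ⋆)‖_∞ ≤ ε`, i.e. every coordinate of
`A(x̄ − ρ⋆)` is at most `ε` in absolute value. -/
theorem partial_l1_penalized_foc {p : ℕ}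
    (A : Matrix (Fin p) (Fin p) ℝ) (hAsymm : A.IsSymm)
    (hApsd : ∀ v : Fin p → ℝ, 0 ≤ v ⬝ᵥ A.mulVec v)
    (xbar : Fin p → ℝ) (ε : ℝ) (hε : 0 < ε) (S : Finset (Fin p))
    (ρstar : Fin p → ℝ)
    (hmin : ∀ v : Fin p → ℝ,
      (xbar - ρstar) ⬝ᵥ A.mulVec (xbar - ρstar) + 2 * ε * ∑ j ∈ S, |ρstar j| ≤
        (xbar - v) ⬝ᵥ A.mulVec (xbar - v) + 2 * ε * ∑ j ∈ S, |v j|) :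
    ∀ j, |A.mulVec (xbar - ρstar) j| ≤ ε := by
  intro j
  have hdiag : 0 ≤ A j j := by simpa using hApsd (Pi.single j 1)
  refine abs_le_of_forall_two_mul_le hdiag fun t => ?_
  have hstep := hmin (ρstar + Pi.single j t)
  rw [← sub_sub, hAsymm.dotProduct_mulVec_sub_single] at hstep
  have hpen := mul_le_mul_of_nonneg_left (sum_abs_add_single_le S ρstar j t)
    (by positivity : 0 ≤ 2 * ε)
  linarith
end

section
/- Let A be a symmetric positive semidefinite real p×p matrix, x ∈ ℝ^p, r > 0, C_E > 0, let J ⊆ {1,…,p} be nonempty, and let N ⊆ J^c with |N| = |J| be such that |x_j| ≤ |x_i| for every i ∈ N and j ∈ J^c \ N. Suppose: (i) xᵀAx ≤ 3r‖x‖₁; (ii) the cone condition ‖x_{J^c}‖₁ ≤ 3‖x_J‖₁; and (iii) the restricted eigenvalue condition C_E·‖x_{J∪N}‖₂² ≤ xᵀAx. Then ‖x‖₂² ≤ 1440·(r/C_E)²·|J|. -/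
open Matrix

/-- If every coordinate on `T` is dominated in absolute value by every coordinate on `N`, then
`|N| ‖x_T‖₂² ≤ ‖x_N‖₁ ‖x_T‖₁`. -/
lemma card_mul_sum_sq_le_of_dominated {ι : Type*} (x : ι → ℝ) (N T : Finset ι)
    (h : ∀ i ∈ N, ∀ j ∈ T, |x j| ≤ |x i|) :
    (N.card : ℝ) * ∑ j ∈ T, x j ^ 2 ≤ (∑ i ∈ N, |x i|) * ∑ j ∈ T, |x j| := by
  rw [Finset.mul_sum, Finset.mul_sum]
  refine Finset.sum_le_sum fun j hj => ?_
  have hle : (N.card : ℝ) * |x j| ≤ ∑ i ∈ N, |x i| := by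
    simpa [nsmul_eq_mul] using
      Finset.card_nsmul_le_sum N (fun i => |x i|) |x j| fun i hi => h i hi j hj
  calc (N.card : ℝ) * x j ^ 2 = (N.card * |x j|) * |x j| := by rw [← sq_abs]; ring
    _ ≤ (∑ i ∈ N, |x i|) * |x j| := by gcongr

/-- Combined deterministic core of Lemma S.10: under the basic inequality
`xᵀAx ≤ 3r‖x‖₁`, the cone condition `‖x_{Jᶜ}‖₁ ≤ 3‖x_J‖₁`, and the restricted
eigenvalue condition `C_E‖x_{J∪N}‖₂² ≤ xᵀAx` (where `N ⊆ Jᶜ` consists of the `|J|`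
largest-magnitude coordinates of `x` within `Jᶜ`), one has
`‖x‖₂² ≤ 1440 (r/C_E)² |J|`. -/
theorem pgmm_l2_error_bound {p : ℕ}
    (A : Matrix (Fin p) (Fin p) ℝ) (hAsymm : A.IsSymm)
    (hApsd : ∀ v : Fin p → ℝ, 0 ≤ v ⬝ᵥ A.mulVec v)
    (x : Fin p → ℝ) (r CE : ℝ) (hr : 0 < r) (hCE : 0 < CE)
    (J : Finset (Fin p)) (hJ : J.Nonempty)
    (N : Finset (Fin p)) (hNsub : N ⊆ Jᶜ) (hcard : N.card = J.card)
    (hN : ∀ i ∈ N, ∀ j ∈ Jᶜ \ N, |x j| ≤ |x i|)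
    (h1 : x ⬝ᵥ A.mulVec x ≤ 3 * r * ∑ j, |x j|)
    (h2 : ∑ j ∈ Jᶜ, |x j| ≤ 3 * ∑ j ∈ J, |x j|)
    (h3 : CE * ∑ j ∈ J ∪ N, x j ^ 2 ≤ x ⬝ᵥ A.mulVec x) :
    ∑ j, x j ^ 2 ≤ 1440 * (r / CE) ^ 2 * J.card := by
  have hs : (0 : ℝ) < J.card := by exact_mod_cast hJ.card_pos
  have hdisj : Disjoint J N :=
    Finset.disjoint_left.2 fun i hiJ hiN => Finset.mem_compl.1 (hNsub hiN) hiJ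
  have htail := card_mul_sum_sq_le_of_dominated x N (Jᶜ \ N) hN
  have hcauchy : (∑ j ∈ J, |x j|) ^ 2 ≤ J.card * ∑ j ∈ J, x j ^ 2 := by
    simpa using sq_sum_le_card_mul_sum_sq (s := J) (f := fun j => |x j|)
  have hl1 := Finset.sum_add_sum_compl J (fun j => |x j|)
  have hl2 := Finset.sum_add_sum_compl J (fun j => x j ^ 2)
  have hc1 := Finset.sum_sdiff (f := fun j => |x j|) hNsub
  have hc2 := Finset.sum_sdiff (f := fun j => x j ^ 2) hNsub
  have ha0 : 0 ≤ ∑ j ∈ J, |x j| := Finset.sum_nonneg fun j _ => abs_nonneg _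
  have hb0 : 0 ≤ ∑ j ∈ N, |x j| := Finset.sum_nonneg fun j _ => abs_nonneg _
  have hM0 : 0 ≤ ∑ j ∈ N, x j ^ 2 := Finset.sum_nonneg fun j _ => sq_nonneg _
  rw [Finset.sum_union hdisj] at h3
  rw [hcard] at htail
  rw [← hl1] at h1
  rw [← hl2, ← hc2]
  rw [← hc1] at h1 h2
  generalize (J.card : ℝ) = s at *
  generalize ∑ j ∈ J, |x j| = a at *
  generalize ∑ j ∈ N, |x j| = b at *
  generalize ∑ j ∈ Jᶜ \ N, |x j| = t at *
  generalize ∑ j ∈ J, x j ^ 2 = Q at *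
  generalize ∑ j ∈ N, x j ^ 2 = R at *
  generalize ∑ j ∈ Jᶜ \ N, x j ^ 2 = T at *
  have htail' : T ≤ 9 * (Q + R) := by
    refine le_of_mul_le_mul_left ?_ hs
    have hbt : b * t ≤ b * (3 * a - b) := by gcongr; linarith
    nlinarith [sq_nonneg (3 * a - 2 * b), mul_nonneg hs.le hM0]
  have hk : Q + R ≤ 12 * (r / CE) * a := by
    have hbound : CE * (Q + R) ≤ 12 * r * a := by nlinarith
    calc Q + R ≤ 12 * r * a / CE := by rwa [le_div_iff₀' hCE]
      _ = 12 * (r / CE) * a := by ring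
  have hk0 : 0 < r / CE := div_pos hr hCE
  generalize r / CE = k at *
  have ha : a ≤ 12 * k * s := by
    rcases ha0.eq_or_lt with h | h
    · rw [← h]; positivity
    · refine le_of_mul_le_mul_left ?_ h
      nlinarith [mul_le_mul_of_nonneg_left hk hs.le, mul_nonneg hs.le hM0]
  nlinarith [mul_le_mul_of_nonneg_left ha hk0.le]
end
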